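/- arXiv:2405.10636 — 4 statements merged into one kernel-verified Lean document; each statement's English description precedes it below -/
import Mathlib

section
/- For all M > 0 and σ² > 0 there exist p₋(M,σ²) > 0, p₊(M,σ²) < 1 and ι(M,σ²) > 0 such that every real random variable X with 0 ≤ X ≤ M almost surely and Var X ≥ σ² admits, for some p with p₋ ≤ p ≤ p₊, a p-Bernoulli decomposition X ≐ Y(t) + Z(t)·ξ in which Z(t) ≥ ι for every t ∈ (0,1). -/
open MeasureTheory ProbabilityTheory

/-- The law of a Bernoulli random variable with success probability `p`,
as a measure on `ℝ` (mass `1 - p` at `0` and `p` at `1`). -/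
noncomputable def bernoulliLaw (p : ℝ) : Measure ℝ :=
  ENNReal.ofReal (1 - p) • Measure.dirac (0 : ℝ) + ENNReal.ofReal p • Measure.dirac (1 : ℝ)

/-- The uniform distribution on `(0,1)`. -/
noncomputable def unif01 : Measure ℝ := volume.restrict (Set.Ioo (0 : ℝ) 1)

/-- `(Y, Z)` is a `p`-Bernoulli decomposition of the random variable `X`:
for `t` uniform on `(0,1)` and `ξ` Bernoulli(`p`) independent of `t`,
`Y t + Z t · ξ` has the same law as `X`. -/
def IsBernoulliDecomp {Ω : Type*} [MeasurableSpace Ω] (P : Measure Ω) (X : Ω → ℝ)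
    (p : ℝ) (Y Z : ℝ → ℝ) : Prop :=
  Measurable Y ∧ Measurable Z ∧
    Measure.map (fun q : ℝ × ℝ => Y q.1 + Z q.1 * q.2) (unif01.prod (bernoulliLaw p)) =
      Measure.map X P

open Set Filter Topology

/-- The quantile function of `μ` on `(0,1)`, extended by `0`. -/
noncomputable def quantile (μ : Measure ℝ) (u : ℝ) : ℝ :=
  open Classical in if u ∈ Ioo (0 : ℝ) 1 then sInf {y | u ≤ cdf μ y} else 0

lemma quantile_le_iff (μ : Measure ℝ) {u : ℝ} (hu : u ∈ Ioo (0 : ℝ) 1) (y : ℝ) :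
    quantile μ u ≤ y ↔ u ≤ cdf μ y := by
  rw [quantile, if_pos hu]
  have hne : {y | u ≤ cdf μ y}.Nonempty :=
    ((tendsto_cdf_atTop μ).eventually_const_le hu.2).exists
  have hbdd : BddBelow {y | u ≤ cdf μ y} := by
    obtain ⟨b, hb⟩ := ((tendsto_cdf_atBot μ).eventually_lt_const hu.1).exists
    exact ⟨b, fun z hz => le_of_not_gt fun h =>
      (hb.trans_le hz).not_ge (monotone_cdf μ h.le)⟩
  refine ⟨fun h => ?_, fun h => csInf_le hbdd h⟩
  have hlim : Tendsto (cdf μ) (𝓝[>] y) (𝓝 (cdf μ y)) :=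
    ((cdf μ).right_continuous y).tendsto.mono_left (nhdsWithin_mono _ Ioi_subset_Ici_self)
  refine ge_of_tendsto hlim (eventually_nhdsWithin_of_forall fun z hz => ?_)
  obtain ⟨s, hs, hsz⟩ := exists_lt_of_csInf_lt hne (lt_of_le_of_lt h hz)
  exact le_trans hs (monotone_cdf μ hsz.le)

lemma lt_quantile_iff (μ : Measure ℝ) {u : ℝ} (hu : u ∈ Ioo (0 : ℝ) 1) (y : ℝ) :
    y < quantile μ u ↔ cdf μ y < u := by
  rw [← not_le, quantile_le_iff μ hu, not_le]

lemma measurable_quantile (μ : Measure ℝ) : Measurable (quantile μ) := by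
  refine measurable_of_Iic fun y => ?_
  have : quantile μ ⁻¹' Iic y =
      (Ioo 0 1 ∩ Iic (cdf μ y)) ∪ ((Ioo 0 1)ᶜ ∩ {_u | 0 ≤ y}) := by
    ext u
    by_cases hu : u ∈ Ioo (0 : ℝ) 1
    · simp only [mem_preimage, mem_Iic, quantile_le_iff μ hu, mem_union, mem_inter_iff, hu,
        mem_compl_iff, true_and, not_true_eq_false, false_and, or_false]
    · simp only [mem_preimage, mem_Iic, quantile, if_false, mem_union, mem_inter_iff, hu,
        mem_compl_iff, true_and, not_false_eq_true, false_and, false_or, mem_ofPred_eq]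
  rw [this]
  exact (measurableSet_Ioo.inter measurableSet_Iic).union
    (measurableSet_Ioo.compl.inter (MeasurableSet.const _))

lemma unif01_Iic (w : ℝ) : unif01 (Iic w) = ENNReal.ofReal (min w 1) := by
  rw [unif01, Measure.restrict_apply measurableSet_Iic]
  rcases lt_or_ge w 1 with h | h
  · have : Iic w ∩ Ioo (0 : ℝ) 1 = Ioc 0 w := by
      ext t
      simp only [mem_inter_iff, mem_Iic, mem_Ioo, mem_Ioc]
      constructor
      · rintro ⟨h1, h2, -⟩
        exact ⟨h2, h1⟩
      · rintro ⟨h1, h2⟩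
        exact ⟨h2, h1, h2.trans_lt h⟩
    rw [this, Real.volume_Ioc, sub_zero, min_eq_left h.le]
  · rw [inter_eq_right.2 fun t ht => ht.2.le.trans h, Real.volume_Ioo, sub_zero, min_eq_right h]

instance : IsProbabilityMeasure unif01 := ⟨by simp [unif01]⟩

lemma unif01_quantile_affine_le (μ : Measure ℝ) {a b : ℝ} (hb : 0 < b) (ha : 0 ≤ a)
    (hab : a + b ≤ 1) (y : ℝ) :
    unif01 {t | quantile μ (a + b * t) ≤ y} = ENNReal.ofReal (min ((cdf μ y - a) / b) 1) := by
  rw [← unif01_Iic]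
  refine measure_congr ?_
  refine (ae_restrict_iff' measurableSet_Ioo).2 (Eventually.of_forall fun t ht => propext ?_)
  have hu : a + b * t ∈ Ioo (0 : ℝ) 1 :=
    ⟨by nlinarith [mul_pos hb ht.1], by nlinarith [mul_lt_mul_of_pos_left ht.2 hb]⟩
  change quantile μ (a + b * t) ≤ y ↔ t ≤ (cdf μ y - a) / b
  rw [quantile_le_iff μ hu, le_div_iff₀ hb]
  constructor <;> intro h <;> linarith

lemma map_prod_bernoulliLaw {p : ℝ} {Y Z : ℝ → ℝ} (hY : Measurable Y) (hZ : Measurable Z) :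
    Measure.map (fun q : ℝ × ℝ => Y q.1 + Z q.1 * q.2) (unif01.prod (bernoulliLaw p)) =
      ENNReal.ofReal (1 - p) • Measure.map Y unif01 +
        ENNReal.ofReal p • Measure.map (fun t => Y t + Z t) unif01 := by
  have hm : Measurable fun q : ℝ × ℝ => Y q.1 + Z q.1 * q.2 := by fun_prop
  have h0 : Measurable fun t : ℝ => (t, (0 : ℝ)) := by fun_prop
  have h1 : Measurable fun t : ℝ => (t, (1 : ℝ)) := by fun_prop
  rw [bernoulliLaw, Measure.prod_add, Measure.prod_smul_right, Measure.prod_smul_right,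
    Measure.map_add _ _ hm, Measure.map_smul, Measure.map_smul, Measure.prod_dirac,
    Measure.prod_dirac, Measure.map_map hm h0, Measure.map_map hm h1]
  simp [Function.comp_def]

/-- Splitting `μ` at the level `1 - p` and pairing the quantiles of the two parts. -/
lemma quantile_split (μ : Measure ℝ) [IsProbabilityMeasure μ] {p : ℝ} (hp : p ∈ Ioo (0 : ℝ) 1) :
    ENNReal.ofReal (1 - p) • Measure.map (fun t => quantile μ (0 + (1 - p) * t)) unif01 +
      ENNReal.ofReal p • Measure.map (fun t => quantile μ ((1 - p) + p * t)) unif01 = μ := by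
  have hq : 0 < 1 - p := by linarith [hp.2]
  have hG := measurable_quantile μ
  have := Measure.isFiniteMeasure_map unif01 (fun t => quantile μ (0 + (1 - p) * t))
  have := Measure.isFiniteMeasure_map unif01 (fun t => quantile μ ((1 - p) + p * t))
  symm
  refine Measure.ext_of_Iic _ _ fun y => ?_
  rw [Measure.add_apply, Measure.smul_apply, Measure.smul_apply,
    Measure.map_apply (by fun_prop) measurableSet_Iic,
    Measure.map_apply (by fun_prop) measurableSet_Iic]
  have e1 := unif01_quantile_affine_le μ hq le_rfl (by linarith [hp.1]) y
  have e2 := unif01_quantile_affine_le μ hp.1 hq.le (by linarith) y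
  simp only [preimage, mem_Iic, smul_eq_mul]
  rw [e1, e2, ← ofReal_cdf, sub_zero, ← ENNReal.ofReal_mul hq.le, ← ENNReal.ofReal_mul hp.1.le,
    mul_min_of_nonneg _ _ hq.le, mul_min_of_nonneg _ _ hp.1.le, mul_div_cancel₀ _ hq.ne',
    mul_div_cancel₀ _ hp.1.ne', mul_one, mul_one]
  have h1 := cdf_le_one μ y
  rcases le_total (cdf μ y) (1 - p) with h | h
  · rw [min_eq_left h, min_eq_left (by linarith [hp.1]),
      ENNReal.ofReal_of_nonpos (sub_nonpos.2 h), add_zero]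
  · rw [min_eq_right h, min_eq_left (by linarith), ← ENNReal.ofReal_add hq.le (by linarith)]
    congr 1
    ring

/-- If `μ` has little mass near a point `x` which has a fair share of mass on either side, then
the quantiles of the parts of `μ` below and above `x` are uniformly separated. -/
lemma le_quantile_sub_quantile (μ : Measure ℝ) {c x ι t : ℝ} (hc : 0 < c) (hc2 : c ≤ 1 / 2)
    (hι : 0 ≤ ι) (hl : c ≤ cdf μ x) (hr : cdf μ x ≤ 1 - c)
    (hgap : cdf μ (x + ι) - cdf μ (x - ι) ≤ c ^ 2) (ht : t ∈ Ioo (0 : ℝ) 1) :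
    ι ≤ quantile μ (cdf μ x + (1 - cdf μ x) * t) - quantile μ (0 + cdf μ x * t) := by
  obtain ⟨ht0, ht1⟩ := ht
  have hm1 : cdf μ x ≤ cdf μ (x + ι) := monotone_cdf μ (by linarith)
  have hm2 : cdf μ (x - ι) ≤ cdf μ x := monotone_cdf μ (by linarith)
  set q := cdf μ x
  have hq : 0 < q := by linarith
  have hp : 0 < 1 - q := by linarith
  have hu1 : q + (1 - q) * t ∈ Ioo (0 : ℝ) 1 := ⟨by positivity, by nlinarith⟩
  have hu0 : 0 + q * t ∈ Ioo (0 : ℝ) 1 := ⟨by nlinarith [mul_pos hq ht0], by nlinarith⟩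
  rcases le_or_gt (0 + q * t) (cdf μ (x - ι)) with h | h
  · have h1 := (quantile_le_iff μ hu0 _).2 h
    have h2 : x < quantile μ (q + (1 - q) * t) :=
      (lt_quantile_iff μ hu1 _).2 (by nlinarith [mul_pos hp ht0])
    linarith
  · have h1 : quantile μ (0 + q * t) ≤ x := (quantile_le_iff μ hu0 _).2 (by nlinarith)
    have h2 : x + ι < quantile μ (q + (1 - q) * t) := by
      rw [lt_quantile_iff μ hu1]
      by_contra! h2
      have h3 : 1 - c < t := by
        by_contra! h3
        nlinarith [mul_le_mul_of_nonneg_left h3 hq.le]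
      have h4 : (1 - q) * (t - c) > 0 := mul_pos hp (by linarith)
      nlinarith
    linarith

lemma exists_isBernoulliDecomp {Ω : Type*} [MeasurableSpace Ω] (P : Measure Ω)
    [IsProbabilityMeasure P] {X : Ω → ℝ} (hX : Measurable X) {c x ι : ℝ} (hc : 0 < c)
    (hc2 : c ≤ 1 / 2) (hι : 0 ≤ ι) (hl : c ≤ cdf (P.map X) x) (hr : cdf (P.map X) x ≤ 1 - c)
    (hgap : cdf (P.map X) (x + ι) - cdf (P.map X) (x - ι) ≤ c ^ 2) :
    ∃ Y Z : ℝ → ℝ, (∀ t ∈ Ioo (0 : ℝ) 1, ι ≤ Z t) ∧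
      IsBernoulliDecomp P X (1 - cdf (P.map X) x) Y Z := by
  have := Measure.isProbabilityMeasure_map (μ := P) hX.aemeasurable
  have hG := measurable_quantile (P.map X)
  set μ := P.map X
  have hY : Measurable fun t => quantile μ (0 + cdf μ x * t) := by fun_prop
  have hYZ : Measurable fun t => quantile μ (cdf μ x + (1 - cdf μ x) * t) := by fun_prop
  refine ⟨_, _, fun t ht => le_quantile_sub_quantile μ hc hc2 hι hl hr hgap ht, hY, hYZ.sub hY, ?_⟩
  refine (map_prod_bernoulliLaw hY (hYZ.sub hY)).trans ?_
  have h := quantile_split μ (p := 1 - cdf μ x) ⟨by linarith, by linarith⟩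
  simpa only [sub_sub_cancel, Pi.sub_apply, add_sub_cancel] using h

/-- The variance of a variable with values in `[0, M]` is controlled by `δ` and the mass outside
the `δ`-neighbourhood of a point `a`. -/
lemma variance_le_of_ae_mem_Icc {Ω : Type*} [MeasurableSpace Ω] (P : Measure Ω)
    [IsProbabilityMeasure P] {X : Ω → ℝ} (hX : Measurable X) {M a : ℝ}
    (hXM : ∀ᵐ ω ∂P, 0 ≤ X ω ∧ X ω ≤ M) (ha0 : 0 ≤ a) (haM : a ≤ M) (δ : ℝ) :
    variance X P ≤
      δ ^ 2 + M ^ 2 * (cdf (P.map X) (a - δ) + (1 - cdf (P.map X) (a + δ))) := by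
  have := Measure.isProbabilityMeasure_map (μ := P) hX.aemeasurable
  have hvar : variance X P ≤ ∫ ω, (X ω - a) ^ 2 ∂P := by
    rw [← variance_sub_const hX.aestronglyMeasurable a]
    exact variance_le_expectation_sq (hX.sub_const a).aestronglyMeasurable
  have hl : cdf (P.map X) (a - δ) = P.real (X ⁻¹' Iic (a - δ)) := by
    rw [cdf_eq_real, map_measureReal_apply hX measurableSet_Iic]
  have hr : 1 - cdf (P.map X) (a + δ) = P.real (X ⁻¹' Ioi (a + δ)) := by
    rw [cdf_eq_real, ← probReal_compl_eq_one_sub measurableSet_Iic, compl_Iic,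
      map_measureReal_apply hX measurableSet_Ioi]
  have hml := hX (measurableSet_Iic (a := a - δ))
  have hmr := hX (measurableSet_Ioi (a := a + δ))
  have hil : Integrable ((X ⁻¹' Iic (a - δ)).indicator fun _ => M ^ 2) P :=
    (integrable_const _).indicator hml
  have hir : Integrable ((X ⁻¹' Ioi (a + δ)).indicator fun _ => M ^ 2) P :=
    (integrable_const _).indicator hmr
  refine hvar.trans ?_
  calc ∫ ω, (X ω - a) ^ 2 ∂P
      ≤ ∫ ω, (δ ^ 2 + ((X ⁻¹' Iic (a - δ)).indicator (fun _ => M ^ 2) ω +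
          (X ⁻¹' Ioi (a + δ)).indicator (fun _ => M ^ 2) ω)) ∂P := by
        refine integral_mono_of_nonneg (Eventually.of_forall fun ω => sq_nonneg _)
          ((integrable_const _).add (hil.add hir)) ?_
        filter_upwards [hXM] with ω hω
        have hsq : (X ω - a) ^ 2 ≤ M ^ 2 := sq_le_sq' (by linarith [hω.1]) (by linarith [hω.2])
        have hM := sq_nonneg M
        have hd := sq_nonneg δ
        by_cases h1 : X ω ≤ a - δ
        · rw [indicator_of_mem (show ω ∈ X ⁻¹' Iic (a - δ) from h1)]
          linarith [indicator_nonneg (s := X ⁻¹' Ioi (a + δ)) (f := fun _ => M ^ 2)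
            (fun _ _ => hM) ω]
        · rw [indicator_of_notMem (show ω ∉ X ⁻¹' Iic (a - δ) from h1)]
          by_cases h2 : a + δ < X ω
          · rw [indicator_of_mem (show ω ∈ X ⁻¹' Ioi (a + δ) from h2)]
            linarith
          · rw [indicator_of_notMem (show ω ∉ X ⁻¹' Ioi (a + δ) from h2)]
            linarith [sq_le_sq' (a := X ω - a) (b := δ) (by linarith) (by linarith)]
    _ = δ ^ 2 + M ^ 2 * (cdf (P.map X) (a - δ) + (1 - cdf (P.map X) (a + δ))) := by
        rw [integral_add (integrable_const _) (by exact hil.add hir), integral_add hil hir,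
          integral_indicator_const _ hml, integral_indicator_const _ hmr, hl, hr]
        simp
        ring

/-- Among `N` consecutive intervals of length `2ι` starting at `a`, one has mass at most `1/N`. -/
lemma exists_cdf_increment_le (μ : Measure ℝ) {N : ℕ} (hN : 0 < N) (a ι : ℝ) :
    ∃ k < N, cdf μ (a + (2 * k + 1) * ι + ι) - cdf μ (a + (2 * k + 1) * ι - ι) ≤ 1 / N := by
  have hN' : (0 : ℝ) < N := by exact_mod_cast hN
  have hsum : ∑ k ∈ Finset.range N, (cdf μ (a + 2 * (k + 1 : ℕ) * ι) - cdf μ (a + 2 * k * ι)) ≤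
      ∑ _k ∈ Finset.range N, (1 / N : ℝ) := by
    rw [Finset.sum_range_sub (fun k : ℕ => cdf μ (a + 2 * k * ι))]
    simp only [Finset.sum_const, Finset.card_range, nsmul_eq_mul]
    rw [mul_one_div_cancel hN'.ne']
    linarith [cdf_le_one μ (a + 2 * N * ι), cdf_nonneg μ (a + 2 * (0 : ℕ) * ι)]
  obtain ⟨k, hk, h⟩ := Finset.exists_le_of_sum_le (Finset.nonempty_range_iff.2 hN.ne') hsum
  refine ⟨k, Finset.mem_range.1 hk, ?_⟩
  have hr : a + (2 * k + 1) * ι + ι = a + 2 * (k + 1 : ℕ) * ι := by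
    push_cast
    ring
  have hl : a + (2 * k + 1) * ι - ι = a + 2 * k * ι := by ring
  rwa [hr, hl]

/-- For all `M > 0`, `σ² > 0` there are `p₋ > 0`, `p₊ < 1`, `ι > 0`
such that every random variable `X` with `0 ≤ X ≤ M` a.s. and `Var X ≥ σ²` admits a
`p`-Bernoulli decomposition with `p₋ ≤ p ≤ p₊` and `Z(t) ≥ ι` for all `t ∈ (0,1)`. -/
theorem stmt_3 (M σsq : ℝ) (hM : 0 < M) (hσ : 0 < σsq) :
    ∃ pm pp ι : ℝ, 0 < pm ∧ pm ≤ pp ∧ pp < 1 ∧ 0 < ι ∧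
      ∀ (Ω : Type) (_ : MeasurableSpace Ω) (P : Measure Ω), IsProbabilityMeasure P →
        ∀ (X : Ω → ℝ), Measurable X →
        (∀ᵐ ω ∂P, 0 ≤ X ω ∧ X ω ≤ M) →
        σsq ≤ variance X P →
        ∃ p : ℝ, pm ≤ p ∧ p ≤ pp ∧
          ∃ Y Z : ℝ → ℝ, (∀ t ∈ Set.Ioo (0:ℝ) 1, ι ≤ Z t) ∧
            IsBernoulliDecomp P X p Y Z := by
  obtain ⟨c, hc0, hc2, hcσ⟩ : ∃ c : ℝ, 0 < c ∧ c ≤ 1 / 2 ∧ M ^ 2 * c ≤ σsq / 4 := by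
    refine ⟨min (1 / 2) (σsq / (4 * M ^ 2)), by positivity, min_le_left _ _, ?_⟩
    calc M ^ 2 * min (1 / 2) (σsq / (4 * M ^ 2)) ≤ M ^ 2 * (σsq / (4 * M ^ 2)) := by
          gcongr
          exact min_le_right _ _
      _ = σsq / 4 := by field_simp
  obtain ⟨δ, hδ, hδσ⟩ : ∃ δ : ℝ, 0 < δ ∧ δ ^ 2 = σsq / 4 :=
    ⟨√(σsq / 4), by positivity, Real.sq_sqrt (by positivity)⟩
  obtain ⟨N, hN⟩ := exists_nat_gt (1 / c ^ 2)
  have hN' : (0 : ℝ) < N := lt_trans (by positivity) hN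
  have hNc : 1 / (N : ℝ) ≤ c ^ 2 := (one_div_lt hN' (by positivity)).2 hN |>.le
  have hι : 0 < δ / (2 * N) := by positivity
  refine ⟨c, 1 - c, δ / (2 * N), hc0, by linarith, by linarith, hι, ?_⟩
  intro Ω _ P _ X hX hXM hvar
  have := Measure.isProbabilityMeasure_map (μ := P) hX.aemeasurable
  have hc1 : c ∈ Set.Ioo (0 : ℝ) 1 := ⟨hc0, by linarith⟩
  obtain ⟨a, ha⟩ : ∃ a, a = quantile (P.map X) c := ⟨_, rfl⟩
  have hca : c ≤ cdf (P.map X) a := (quantile_le_iff _ hc1 a).1 ha.ge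
  have hlt : cdf (P.map X) (a - δ) < c := (lt_quantile_iff _ hc1 _).1 (by linarith)
  have ha0 : 0 ≤ a := by
    refine ha ▸ le_of_not_gt fun h => ?_
    have h1 := (quantile_le_iff (P.map X) hc1 _).1 le_rfl
    rw [cdf_eq_real, map_measureReal_apply hX measurableSet_Iic, measureReal_def,
      measure_eq_zero_iff_ae_notMem.2 (hXM.mono fun ω hω hm => ?_)] at h1
    · exact hc0.not_ge (by simpa using h1)
    · exact (lt_of_le_of_lt hm h).not_ge hω.1
  have haM : a ≤ M := by
    rw [ha, quantile_le_iff _ hc1, cdf_eq_real, map_measureReal_apply hX measurableSet_Iic,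
      measureReal_def, prob_compl_eq_zero_iff (hX measurableSet_Iic) |>.1
        (measure_eq_zero_iff_ae_notMem.2 (hXM.mono fun ω hω hm => hm hω.2))]
    simpa using hc1.2.le
  have hupper : cdf (P.map X) (a + δ) ≤ 1 - c := by
    by_contra! h
    have h1 := variance_le_of_ae_mem_Icc P hX hXM ha0 haM δ
    have h2 : M ^ 2 * (cdf (P.map X) (a - δ) + (1 - cdf (P.map X) (a + δ))) ≤ M ^ 2 * (c + c) := by
      gcongr
      linarith
    linarith
  obtain ⟨k, hk, hgap⟩ :=
    exists_cdf_increment_le (P.map X) (Nat.cast_pos.1 hN') a (δ / (2 * N))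
  have hx : (2 * k + 1) * (δ / (2 * N)) ≤ δ := by
    have : (k : ℝ) + 1 ≤ N := by exact_mod_cast hk
    rw [mul_div_assoc', div_le_iff₀ (by positivity)]
    nlinarith
  have hl : c ≤ cdf (P.map X) (a + (2 * k + 1) * (δ / (2 * N))) :=
    hca.trans (monotone_cdf _ (le_add_of_nonneg_right (by positivity)))
  have hr : cdf (P.map X) (a + (2 * k + 1) * (δ / (2 * N))) ≤ 1 - c :=
    (monotone_cdf _ (by linarith)).trans hupper
  exact ⟨_, by linarith, by linarith,
    exists_isBernoulliDecomp P hX hc0 hc2 hι.le hl hr (hgap.trans hNc)⟩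
end

section
/- Let N ≥ 1, let ξ be a random subset of {1,…,N} with non-trivial product distribution with parameters p₁,…,p_N, and let 0 < β ≤ min{p_k, 1 − p_k} for all k. Then for every κ ∈ (0,1] and every κ-Sperner family A ⊆ 2^{{1,…,N}}: Σ_{k=0}^{N} P[ξ ∈ A | |ξ| = k] ≤ (1 − β)²/(β²·κ), where P[ξ ∈ A | |ξ| = k] = P[ξ ∈ A and |ξ| = k] / P[|ξ| = k] (note P[|ξ| = k] > 0 for every 0 ≤ k ≤ N). -/
open Finset

/-- The product-measure weight of the subset `η` of `Fin N`, with parameters `p`. -/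
def prodWeight {N : ℕ} (p : Fin N → ℝ) (η : Finset (Fin N)) : ℝ :=
  (∏ k ∈ η, p k) * ∏ k ∈ ηᶜ, (1 - p k)

/-- A family `A` of subsets of `Fin N` is `κ`-Sperner if for every `η ∈ A` there is
`B ⊆ ηᶜ` with `|B| ≥ κ·|ηᶜ|` such that every `η' ∈ A` containing `η` is disjoint from `B`. -/
def IsSpernerFamily {N : ℕ} (κ : ℝ) (A : Finset (Finset (Fin N))) : Prop :=
  ∀ η ∈ A, ∃ B : Finset (Fin N), B ⊆ ηᶜ ∧ κ * (ηᶜ.card : ℝ) ≤ (B.card : ℝ) ∧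
    ∀ η' ∈ A, η ⊆ η' → η' ∩ B = ∅

/-- The total weight of the subsets of size `k`. -/
noncomputable def levelWeight {N : ℕ} (p : Fin N → ℝ) (k : ℕ) : ℝ :=
  ∑ η ∈ univ.filter (fun η : Finset (Fin N) => η.card = k), prodWeight p η

/-- The average of `1 / |ζ \ η|` over the sets `ζ ∋ j` of size `|η| + 1`, up to normalization. -/
noncomputable def addWeight {N : ℕ} (p : Fin N → ℝ) (η : Finset (Fin N)) (j : Fin N) : ℝ :=
  ∑ ζ ∈ univ.filter (fun ζ : Finset (Fin N) => ζ.card = η.card + 1 ∧ j ∈ ζ),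
    prodWeight p ζ / ((ζ \ η).card : ℝ)

/-- The probability of adding `j` to `η` in a monotone Markov chain whose marginals are the
product distribution conditioned on its size: draw an independent `ζ` of size `|η| + 1` and pick
an element of `ζ \ η` uniformly. -/
noncomputable def addProb {N : ℕ} (p : Fin N → ℝ) (η : Finset (Fin N)) (j : Fin N) : ℝ :=
  addWeight p η j / levelWeight p (η.card + 1)

/-- The expected number of visits to `A` of the chain started at `η`, during `n` steps. -/
noncomputable def expectedVisits {N : ℕ} (p : Fin N → ℝ) (A : Finset (Finset (Fin N))) :
    ℕ → Finset (Fin N) → ℝ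
  | 0, η => if η ∈ A then 1 else 0
  | n + 1, η => (if η ∈ A then 1 else 0) +
      ∑ j ∈ ηᶜ, addProb p η j * expectedVisits p A n (insert j η)

section

variable {N : ℕ} {p : Fin N → ℝ}

lemma prodWeight_eq_prod_ite (η : Finset (Fin N)) :
    prodWeight p η = ∏ k, if k ∈ η then p k else 1 - p k := by
  rw [prodWeight, Finset.prod_ite]
  congr 1
  · congr 1; ext; simp
  · congr 1; ext; simp

lemma prodWeight_pos (h0 : ∀ k, 0 < p k) (h1 : ∀ k, 0 < 1 - p k) (η : Finset (Fin N)) :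
    0 < prodWeight p η :=
  mul_pos (prod_pos fun k _ => h0 k) (prod_pos fun k _ => h1 k)

lemma levelWeight_pos (h0 : ∀ k, 0 < p k) (h1 : ∀ k, 0 < 1 - p k) {k : ℕ} (hk : k ≤ N) :
    0 < levelWeight p k := by
  refine sum_pos (fun η _ => prodWeight_pos h0 h1 η) ?_
  obtain ⟨s, -, hs⟩ := exists_subset_card_eq (s := (univ : Finset (Fin N))) (n := k) (by simpa)
  exact ⟨s, by simpa using hs⟩

lemma prodWeight_insert_mul_erase {η ζ : Finset (Fin N)} {j : Fin N} (hη : j ∉ η) (hζ : j ∈ ζ) :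
    prodWeight p (insert j η) * prodWeight p (ζ.erase j) = prodWeight p η * prodWeight p ζ := by
  simp only [prodWeight_eq_prod_ite, ← prod_mul_distrib]
  refine prod_congr rfl fun k _ => ?_
  by_cases hk : k = j
  · subst hk; simp [hη, hζ, mul_comm]
  · simp [hk]

lemma card_sdiff_pos_of_card_eq {η ζ : Finset (Fin N)} (h : ζ.card = η.card + 1) :
    0 < (ζ \ η).card := by
  have := le_card_sdiff η ζ
  omega

lemma card_insert_sdiff_erase {η ζ : Finset (Fin N)} {j : Fin N} (h : ζ.card = η.card + 1)
    (hη : j ∉ η) : (insert j η \ ζ.erase j).card = (ζ \ η).card := by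
  have e : insert j η \ ζ.erase j = insert j (η \ ζ) := by
    ext x; by_cases hx : x = j <;> simp [hx]
  rw [e, card_insert_of_notMem (by simp [hη])]
  have h1 := card_sdiff_add_card_inter η ζ
  have h2 := card_sdiff_add_card_inter ζ η
  rw [inter_comm] at h2
  omega

/-- The bijection `(η, ζ, j) ↦ (ζ \ {j}, η ∪ {j}, j)` exchanges the two sums. -/
lemma sum_exchange (k : ℕ) (F : Finset (Fin N) → ℝ) :
    ∑ x ∈ (univ : Finset (Finset (Fin N) × Finset (Fin N) × Fin N)).filter
        (fun x => x.1.card = k ∧ x.2.1.card = k + 1 ∧ x.2.2 ∈ x.2.1 ∧ x.2.2 ∉ x.1),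
      prodWeight p x.1 * prodWeight p x.2.1 / ((x.2.1 \ x.1).card : ℝ) * F (insert x.2.2 x.1) =
    ∑ x ∈ (univ : Finset (Finset (Fin N) × Finset (Fin N) × Fin N)).filter
        (fun x => x.1.card = k ∧ x.2.1.card = k + 1 ∧ x.2.2 ∈ x.2.1 ∧ x.2.2 ∉ x.1),
      prodWeight p x.1 * prodWeight p x.2.1 / ((x.2.1 \ x.1).card : ℝ) * F x.2.1 := by
  refine sum_nbij' (fun x => (x.2.1.erase x.2.2, insert x.2.2 x.1, x.2.2))
    (fun x => (x.2.1.erase x.2.2, insert x.2.2 x.1, x.2.2)) ?_ ?_ ?_ ?_ ?_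
  · rintro ⟨η, ζ, j⟩ h
    simp only [mem_filter, mem_univ, true_and] at h ⊢
    obtain ⟨h1, h2, h3, h4⟩ := h
    simp [card_erase_of_mem h3, card_insert_of_notMem h4, h1, h2]
  · rintro ⟨η, ζ, j⟩ h
    simp only [mem_filter, mem_univ, true_and] at h ⊢
    obtain ⟨h1, h2, h3, h4⟩ := h
    simp [card_erase_of_mem h3, card_insert_of_notMem h4, h1, h2]
  · rintro ⟨η, ζ, j⟩ h
    simp only [mem_filter, mem_univ, true_and] at h
    obtain ⟨h1, h2, h3, h4⟩ := h
    simp [erase_insert h4, insert_erase h3]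
  · rintro ⟨η, ζ, j⟩ h
    simp only [mem_filter, mem_univ, true_and] at h
    obtain ⟨h1, h2, h3, h4⟩ := h
    simp [erase_insert h4, insert_erase h3]
  · rintro ⟨η, ζ, j⟩ h
    simp only [mem_filter, mem_univ, true_and] at h
    obtain ⟨h1, h2, h3, h4⟩ := h
    simp only
    rw [card_insert_sdiff_erase (by omega) h4, mul_comm (prodWeight p (ζ.erase j)),
      prodWeight_insert_mul_erase h4 h3]

lemma sum_prodWeight_mul_sum_addWeight (k : ℕ) (F : Finset (Fin N) → ℝ) :
    ∑ η ∈ univ.filter (fun η : Finset (Fin N) => η.card = k),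
      prodWeight p η * ∑ j ∈ ηᶜ, addWeight p η j * F (insert j η) =
    levelWeight p k * ∑ ζ ∈ univ.filter (fun ζ : Finset (Fin N) => ζ.card = k + 1),
      prodWeight p ζ * F ζ := by
  trans ∑ η ∈ univ.filter (fun η : Finset (Fin N) => η.card = k),
      ∑ ζ ∈ univ.filter (fun ζ : Finset (Fin N) => ζ.card = k + 1), ∑ j ∈ ζ \ η,
        prodWeight p η * prodWeight p ζ / ((ζ \ η).card : ℝ) * F (insert j η)
  · refine sum_congr rfl fun η hη => ?_
    simp only [mem_filter, mem_univ, true_and] at hη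
    simp only [addWeight, mul_sum, sum_mul]
    rw [sum_comm' (t' := univ.filter (fun ζ : Finset (Fin N) => ζ.card = k + 1))
      (s' := fun ζ => ζ \ η)]
    · refine sum_congr rfl fun ζ _ => sum_congr rfl fun j _ => ?_
      ring
    · intro j ζ
      simp only [mem_filter, mem_univ, true_and, mem_compl, mem_sdiff, hη]
      tauto
  trans ∑ η ∈ univ.filter (fun η : Finset (Fin N) => η.card = k),
      ∑ ζ ∈ univ.filter (fun ζ : Finset (Fin N) => ζ.card = k + 1), ∑ j ∈ ζ \ η,
        prodWeight p η * prodWeight p ζ / ((ζ \ η).card : ℝ) * F ζ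
  · have key := sum_exchange (p := p) k F
    simp only [sum_filter, Fintype.sum_prod_type] at key
    have conv : ∀ G : Finset (Fin N) → Finset (Fin N) → Fin N → ℝ,
        ∑ η ∈ univ.filter (fun η : Finset (Fin N) => η.card = k),
          ∑ ζ ∈ univ.filter (fun ζ : Finset (Fin N) => ζ.card = k + 1), ∑ j ∈ ζ \ η, G η ζ j =
        ∑ η, ∑ ζ, ∑ j, if η.card = k ∧ ζ.card = k + 1 ∧ j ∈ ζ ∧ j ∉ η then G η ζ j else 0 := by
      intro G
      rw [sum_filter]
      refine sum_congr rfl fun η _ => ?_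
      by_cases hη : η.card = k
      · rw [if_pos hη, sum_filter]
        refine sum_congr rfl fun ζ _ => ?_
        by_cases hζ : ζ.card = k + 1
        · simp only [hη, hζ, true_and, if_true, ← mem_sdiff]
          rw [← sum_filter]
          congr 1
          ext; simp
        · simp [hζ]
      · simp [hη]
    rw [conv, conv]
    exact key
  · rw [levelWeight, sum_mul]
    refine sum_congr rfl fun η hη => ?_
    rw [mul_sum]
    refine sum_congr rfl fun ζ hζ => ?_
    simp only [mem_filter, mem_univ, true_and] at hη hζ
    have : ((ζ \ η).card : ℝ) ≠ 0 := by
      have := card_sdiff_pos_of_card_eq (hζ.trans (by rw [hη]))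
      positivity
    rw [sum_const, nsmul_eq_mul]
    field_simp

lemma sum_addWeight (η : Finset (Fin N)) :
    ∑ j ∈ ηᶜ, addWeight p η j = levelWeight p (η.card + 1) := by
  simp only [addWeight]
  rw [sum_comm' (t' := univ.filter (fun ζ : Finset (Fin N) => ζ.card = η.card + 1))
    (s' := fun ζ => ζ \ η)]
  · refine sum_congr rfl fun ζ hζ => ?_
    simp only [mem_filter, mem_univ, true_and] at hζ
    have : ((ζ \ η).card : ℝ) ≠ 0 := by
      have := card_sdiff_pos_of_card_eq hζ
      positivity
    rw [sum_const, nsmul_eq_mul]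
    field_simp
  · intro j ζ
    simp only [mem_filter, mem_univ, true_and, mem_compl, mem_sdiff]
    tauto

lemma addWeight_nonneg (h0 : ∀ k, 0 < p k) (h1 : ∀ k, 0 < 1 - p k) (η : Finset (Fin N))
    (j : Fin N) : 0 ≤ addWeight p η j :=
  sum_nonneg fun ζ _ => div_nonneg (prodWeight_pos h0 h1 ζ).le (Nat.cast_nonneg _)

lemma sq_mul_prodWeight_le {β : ℝ} (hβ : 0 < β) (hp : ∀ k, β ≤ p k) (hq : ∀ k, β ≤ 1 - p k)
    {i j : Fin N} (hij : i ≠ j) {ζ ζ' : Finset (Fin N)}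
    (h : ∀ k, k ≠ i → k ≠ j → (k ∈ ζ ↔ k ∈ ζ')) :
    β ^ 2 * prodWeight p ζ ≤ (1 - β) ^ 2 * prodWeight p ζ' := by
  simp only [prodWeight_eq_prod_ite]
  have hj : j ∈ univ.erase i := by simp [hij.symm]
  have hlow : ∀ (s : Finset (Fin N)) k, β ≤ if k ∈ s then p k else 1 - p k := by
    intro s k; split_ifs <;> [exact hp k; exact hq k]
  have hhigh : ∀ (s : Finset (Fin N)) k, (if k ∈ s then p k else 1 - p k) ≤ 1 - β := by
    intro s k; split_ifs <;> linarith [hp k, hq k]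
  rw [← mul_prod_erase univ _ (mem_univ i), ← mul_prod_erase univ _ (mem_univ i),
    ← mul_prod_erase _ _ hj, ← mul_prod_erase _ _ hj]
  have hR : ∏ k ∈ (univ.erase i).erase j, (if k ∈ ζ then p k else 1 - p k) =
      ∏ k ∈ (univ.erase i).erase j, (if k ∈ ζ' then p k else 1 - p k) := by
    refine prod_congr rfl fun k hk => ?_
    simp only [mem_erase, mem_univ, and_true] at hk
    simp only [h k hk.2 hk.1]
  rw [hR]
  have hRnn : 0 ≤ ∏ k ∈ (univ.erase i).erase j, (if k ∈ ζ' then p k else 1 - p k) :=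
    prod_nonneg fun k _ => hβ.le.trans (hlow ζ' k)
  have hβ1 : 0 ≤ 1 - β := by linarith [hp i, hq i]
  have hmul : β ^ 2 * ((if i ∈ ζ then p i else 1 - p i) * (if j ∈ ζ then p j else 1 - p j)) ≤
      (1 - β) ^ 2 * ((if i ∈ ζ' then p i else 1 - p i) * (if j ∈ ζ' then p j else 1 - p j)) := by
    have a := mul_le_mul (hhigh ζ i) (hhigh ζ j) (hβ.le.trans (hlow ζ j)) hβ1
    have b := mul_le_mul (hlow ζ' i) (hlow ζ' j) hβ.le (hβ.le.trans (hlow ζ' i))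
    nlinarith [mul_le_mul_of_nonneg_left a (sq_nonneg β),
      mul_le_mul_of_nonneg_left b (sq_nonneg (1 - β))]
  have := mul_le_mul_of_nonneg_right hmul hRnn
  linarith

lemma sq_mul_addWeight_le {β : ℝ} (hβ : 0 < β) (hp : ∀ k, β ≤ p k) (hq : ∀ k, β ≤ 1 - p k)
    {η : Finset (Fin N)} {i j : Fin N} (hi : i ∉ η) (hj : j ∉ η) :
    β ^ 2 * addWeight p η i ≤ (1 - β) ^ 2 * addWeight p η j := by
  have h0 : ∀ k, 0 < p k := fun k => hβ.trans_le (hp k)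
  have h1 : ∀ k, 0 < 1 - p k := fun k => hβ.trans_le (hq k)
  by_cases hij : i = j
  · subst hij
    refine mul_le_mul_of_nonneg_right ?_ (addWeight_nonneg h0 h1 η i)
    exact pow_le_pow_left₀ hβ.le (by linarith [hp i, hq i]) 2
  set σ : Fin N ↪ Fin N := (Equiv.swap i j).toEmbedding with hσ
  have hσσ : ∀ s : Finset (Fin N), (s.map σ).map σ = s := by
    intro s; ext x; simp [hσ]
  have hση : η.map σ = η := by
    ext x
    simp only [hσ, mem_map_equiv, Equiv.symm_swap]
    by_cases hxi : x = i
    · subst hxi; simp [hi, hj]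
    by_cases hxj : x = j
    · subst hxj; simp [hi, hj]
    rw [Equiv.swap_apply_of_ne_of_ne hxi hxj]
  have e : addWeight p η j =
      ∑ ζ ∈ univ.filter (fun ζ : Finset (Fin N) => ζ.card = η.card + 1 ∧ i ∈ ζ),
        prodWeight p (ζ.map σ) / ((ζ \ η).card : ℝ) := by
    refine (sum_nbij' (fun ζ => ζ.map σ) (fun ζ => ζ.map σ) ?_ ?_ ?_ ?_ ?_).symm
    · intro ζ h
      simpa [hσ] using h
    · intro ζ h
      simpa [hσ] using h
    · intro ζ _; exact hσσ ζ
    · intro ζ _; exact hσσ ζ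
    · intro ζ _
      congr 2
      conv_rhs => rw [← hση, ← Finset.map_sdiff, card_map]
  rw [e, addWeight, mul_sum, mul_sum]
  refine sum_le_sum fun ζ _ => ?_
  rw [← mul_div_assoc, ← mul_div_assoc]
  refine div_le_div_of_nonneg_right (sq_mul_prodWeight_le hβ hp hq hij fun k hki hkj => ?_)
    (Nat.cast_nonneg _)
  simp only [hσ, mem_map_equiv, Equiv.symm_swap]
  rw [Equiv.swap_apply_of_ne_of_ne hki hkj]

lemma addProb_nonneg (h0 : ∀ k, 0 < p k) (h1 : ∀ k, 0 < 1 - p k) (η : Finset (Fin N))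
    (j : Fin N) : 0 ≤ addProb p η j :=
  div_nonneg (addWeight_nonneg h0 h1 η j) (sum_nonneg fun ζ _ => (prodWeight_pos h0 h1 ζ).le)

lemma sum_addProb (h0 : ∀ k, 0 < p k) (h1 : ∀ k, 0 < 1 - p k) {η : Finset (Fin N)}
    (hη : η.card + 1 ≤ N) : ∑ j ∈ ηᶜ, addProb p η j = 1 := by
  simp only [addProb]
  rw [← sum_div, sum_addWeight, div_self (levelWeight_pos h0 h1 hη).ne']

lemma sq_le_card_compl_mul_addProb {β : ℝ} (hβ : 0 < β) (hp : ∀ k, β ≤ p k)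
    (hq : ∀ k, β ≤ 1 - p k) {η : Finset (Fin N)} (hη : η.card + 1 ≤ N) {j : Fin N} (hj : j ∉ η) :
    β ^ 2 ≤ (1 - β) ^ 2 * ((ηᶜ.card : ℝ) * addProb p η j) := by
  have h0 : ∀ k, 0 < p k := fun k => hβ.trans_le (hp k)
  have h1 : ∀ k, 0 < 1 - p k := fun k => hβ.trans_le (hq k)
  have key : ∑ i ∈ ηᶜ, β ^ 2 * addProb p η i ≤ ∑ i ∈ ηᶜ, (1 - β) ^ 2 * addProb p η j := by
    refine sum_le_sum fun i hi => ?_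
    rw [addProb, addProb, ← mul_div_assoc, ← mul_div_assoc]
    exact div_le_div_of_nonneg_right (sq_mul_addWeight_le hβ hp hq (mem_compl.1 hi) hj)
      (levelWeight_pos h0 h1 hη).le
  rw [← mul_sum, sum_addProb h0 h1 hη, sum_const, nsmul_eq_mul] at key
  linarith

/-- One step of the chain maps the law on level `k` to the law on level `k + 1`. -/
lemma sum_prodWeight_div_mul_sum_addProb (h0 : ∀ k, 0 < p k) (h1 : ∀ k, 0 < 1 - p k) {k : ℕ}
    (hk : k ≤ N) (F : Finset (Fin N) → ℝ) :
    (∑ η ∈ univ.filter (fun η : Finset (Fin N) => η.card = k),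
      prodWeight p η * ∑ j ∈ ηᶜ, addProb p η j * F (insert j η)) / levelWeight p k =
    (∑ ζ ∈ univ.filter (fun ζ : Finset (Fin N) => ζ.card = k + 1),
      prodWeight p ζ * F ζ) / levelWeight p (k + 1) := by
  have e : ∑ η ∈ univ.filter (fun η : Finset (Fin N) => η.card = k),
      prodWeight p η * ∑ j ∈ ηᶜ, addProb p η j * F (insert j η) =
      (∑ η ∈ univ.filter (fun η : Finset (Fin N) => η.card = k),
      prodWeight p η * ∑ j ∈ ηᶜ, addWeight p η j * F (insert j η)) / levelWeight p (k + 1) := by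
    rw [sum_div]
    refine sum_congr rfl fun η hη => ?_
    simp only [mem_filter, mem_univ, true_and] at hη
    rw [mul_div_assoc, sum_div]
    congr 1
    refine sum_congr rfl fun j _ => ?_
    rw [addProb, hη]
    ring
  rw [e, sum_prodWeight_mul_sum_addWeight]
  have := (levelWeight_pos h0 h1 hk).ne'
  field_simp

lemma expectedVisits_eq_zero {A : Finset (Finset (Fin N))} (n : ℕ) {η : Finset (Fin N)}
    (h : ∀ ζ ∈ A, ¬ η ⊆ ζ) : expectedVisits p A n η = 0 := by
  induction n generalizing η with
  | zero => simpa [expectedVisits] using fun hη => h η hη subset_rfl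
  | succ n ih =>
    have hη : η ∉ A := fun hη => h η hη subset_rfl
    simp only [expectedVisits, hη, if_false, zero_add]
    refine sum_eq_zero fun j _ => ?_
    rw [ih fun ζ hζ hs => h ζ hζ ((subset_insert j η).trans hs), mul_zero]

lemma expectedVisits_le {β κ : ℝ} (hβ : 0 < β) (hβ2 : β ≤ 1 - β) (hp : ∀ k, β ≤ p k)
    (hq : ∀ k, β ≤ 1 - p k) (hκ0 : 0 < κ) (hκ1 : κ ≤ 1) {A : Finset (Finset (Fin N))}
    (hA : IsSpernerFamily κ A) (n : ℕ) {η : Finset (Fin N)} (hη : η.card + n = N) :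
    expectedVisits p A n η ≤ (1 - β) ^ 2 / (β ^ 2 * κ) := by
  have h0 : ∀ k, 0 < p k := fun k => hβ.trans_le (hp k)
  have h1 : ∀ k, 0 < 1 - p k := fun k => hβ.trans_le (hq k)
  have hβ1 : 0 < 1 - β := hβ.trans_le hβ2
  set C := (1 - β) ^ 2 / (β ^ 2 * κ) with hC
  have hC1 : 1 ≤ C := by
    rw [hC, one_le_div (by positivity)]
    have : β ^ 2 ≤ (1 - β) ^ 2 := pow_le_pow_left₀ hβ.le hβ2 2
    nlinarith [sq_nonneg β]
  induction n generalizing η with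
  | zero =>
    rw [expectedVisits]
    split_ifs <;> linarith
  | succ n ih =>
    have hη1 : η.card + 1 ≤ N := by omega
    have hstep : ∀ j ∈ ηᶜ, expectedVisits p A n (insert j η) ≤ C := by
      intro j hj
      refine ih ?_
      rw [card_insert_of_notMem (mem_compl.1 hj)]
      omega
    have hsum := sum_addProb h0 h1 hη1
    rw [expectedVisits]
    split_ifs with hηA
    · obtain ⟨B, hBη, hBcard, hB⟩ := hA η hηA
      have hsplit := sum_sdiff (f := fun j => addProb p η j) hBη
      have hsplit' := sum_sdiff
        (f := fun j => addProb p η j * expectedVisits p A n (insert j η)) hBη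
      have hzero : ∑ j ∈ B, addProb p η j * expectedVisits p A n (insert j η) = 0 := by
        refine sum_eq_zero fun j hj => ?_
        rw [expectedVisits_eq_zero, mul_zero]
        intro ζ hζ hs
        have hd := hB ζ hζ ((subset_insert j η).trans hs)
        have hmem : j ∈ ζ ∩ B := mem_inter.2 ⟨hs (mem_insert_self j η), hj⟩
        simp [hd] at hmem
      have hrest : ∑ j ∈ ηᶜ \ B, addProb p η j * expectedVisits p A n (insert j η) ≤
          (∑ j ∈ ηᶜ \ B, addProb p η j) * C := by
        rw [sum_mul]
        exact sum_le_sum fun j hj => mul_le_mul_of_nonneg_left (hstep j (mem_sdiff.1 hj).1)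
          (addProb_nonneg h0 h1 η j)
      have hcpos : (0 : ℝ) < ηᶜ.card := by
        have : 0 < ηᶜ.card := by rw [card_compl, Fintype.card_fin]; omega
        exact_mod_cast this
      have hBprob : 1 ≤ (∑ j ∈ B, addProb p η j) * C := by
        have hlow : ∑ j ∈ B, β ^ 2 ≤
            ∑ j ∈ B, (1 - β) ^ 2 * ((ηᶜ.card : ℝ) * addProb p η j) :=
          sum_le_sum fun j hj =>
            sq_le_card_compl_mul_addProb hβ hp hq hη1 (mem_compl.1 (hBη hj))
        rw [sum_const, nsmul_eq_mul, ← mul_sum, ← mul_sum] at hlow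
        have hmul := (mul_le_mul_of_nonneg_right hBcard (sq_nonneg β)).trans hlow
        have hfin : β ^ 2 * κ ≤ (∑ j ∈ B, addProb p η j) * (1 - β) ^ 2 := by
          refine le_of_mul_le_mul_left ?_ hcpos
          linarith
        rw [hC, ← mul_div_assoc, one_le_div (by positivity)]
        exact hfin
      rw [← hsplit', hzero]
      have : ∑ j ∈ ηᶜ \ B, addProb p η j = 1 - ∑ j ∈ B, addProb p η j := by linarith
      rw [this] at hrest
      linarith
    · rw [zero_add]
      calc ∑ j ∈ ηᶜ, addProb p η j * expectedVisits p A n (insert j η)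
          ≤ ∑ j ∈ ηᶜ, addProb p η j * C := sum_le_sum fun j hj =>
            mul_le_mul_of_nonneg_left (hstep j hj) (addProb_nonneg h0 h1 η j)
        _ = C := by rw [← sum_mul, hsum, one_mul]

lemma sum_prodWeight_mul_expectedVisits (h0 : ∀ k, 0 < p k) (h1 : ∀ k, 0 < 1 - p k)
    (A : Finset (Finset (Fin N))) (n : ℕ) {k : ℕ} (hk : k + n = N) :
    (∑ η ∈ univ.filter (fun η : Finset (Fin N) => η.card = k),
      prodWeight p η * expectedVisits p A n η) / levelWeight p k =
    ∑ l ∈ range (n + 1), (∑ η ∈ A.filter (fun η => η.card = k + l), prodWeight p η) /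
      levelWeight p (k + l) := by
  have hind : ∀ k, ∑ η ∈ univ.filter (fun η : Finset (Fin N) => η.card = k),
      prodWeight p η * (if η ∈ A then 1 else 0) =
      ∑ η ∈ A.filter (fun η => η.card = k), prodWeight p η := by
    intro k
    simp only [mul_ite, mul_one, mul_zero]
    rw [← sum_filter]
    congr 1
    ext; simp [and_comm]
  induction n generalizing k with
  | zero => simp only [expectedVisits, hind]; simp
  | succ n ih =>
    simp only [expectedVisits, mul_add, sum_add_distrib, add_div]
    rw [hind, sum_prodWeight_div_mul_sum_addProb h0 h1 (by omega), ih (by omega),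
      sum_range_succ' _ (n + 1), add_comm]
    simp only [add_zero, add_assoc, add_comm 1]

end

/-- generalized LYM inequality. For a random subset `ξ` of `{1,…,N}` with
non-trivial product distribution with parameters `p k ∈ [β, 1−β]` and a `κ`-Sperner family
`A`, one has `Σ_{k=0}^{N} P[ξ ∈ A | |ξ| = k] ≤ (1−β)²/(β²·κ)`. -/
theorem stmt_6 (N : ℕ) (hN : 1 ≤ N) (p : Fin N → ℝ) (β : ℝ)
    (hβ : 0 < β) (hβp : ∀ k, β ≤ min (p k) (1 - p k))
    (κ : ℝ) (hκ0 : 0 < κ) (hκ1 : κ ≤ 1)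
    (A : Finset (Finset (Fin N))) (hA : IsSpernerFamily κ A) :
    ∑ k ∈ Finset.range (N + 1),
      (∑ η ∈ A.filter (fun η => η.card = k), prodWeight p η) /
        (∑ η ∈ Finset.univ.filter (fun η : Finset (Fin N) => η.card = k), prodWeight p η)
      ≤ (1 - β) ^ 2 / (β ^ 2 * κ) := by
  have hp : ∀ k, β ≤ p k := fun k => (hβp k).trans (min_le_left _ _)
  have hq : ∀ k, β ≤ 1 - p k := fun k => (hβp k).trans (min_le_right _ _)
  have h0 : ∀ k, 0 < p k := fun k => hβ.trans_le (hp k)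
  have h1 : ∀ k, 0 < 1 - p k := fun k => hβ.trans_le (hq k)
  have hβ2 : β ≤ 1 - β := by linarith [hp ⟨0, hN⟩, hq ⟨0, hN⟩]
  have key := sum_prodWeight_mul_expectedVisits h0 h1 A N (Nat.zero_add N)
  simp only [zero_add] at key
  change ∑ k ∈ range (N + 1), (∑ η ∈ A.filter (fun η => η.card = k), prodWeight p η) /
    levelWeight p k ≤ _
  rw [← key, div_le_iff₀ (levelWeight_pos h0 h1 (Nat.zero_le N)), levelWeight, mul_sum]
  refine sum_le_sum fun η hη => ?_
  simp only [mem_filter, mem_univ, true_and] at hη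
  rw [mul_comm]
  exact mul_le_mul_of_nonneg_right
    (expectedVisits_le hβ hβ2 hp hq hκ0 hκ1 hA N (by omega)) (prodWeight_pos h0 h1 η).le
end

section
/- For every β ∈ (0, 1/2] there exists a constant C_β > 0, depending only on β, with the following property: for every N ≥ 1, every random subset ξ of {1,…,N} with non-trivial product distribution with parameters p₁,…,p_N satisfying β ≤ min{p_k, 1 − p_k} for all k, every κ ∈ (0,1], and every κ-Sperner family A ⊆ 2^{{1,…,N}}, one has P[ξ ∈ A] ≤ C_β/(κ·√N). -/
open Finset

/-- The total LYM weight of the members of `F` in the interval `[T, T ∪ S]`. -/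
noncomputable def lymSum {N : ℕ} (F : Finset (Finset (Fin N))) (S T : Finset (Fin N)) : ℝ :=
  ∑ η ∈ F with T ⊆ η ∧ η \ T ⊆ S, ((S.card.choose (η \ T).card : ℝ))⁻¹

/-- Averaging the LYM weights over the one-point extensions of the lower end `T`. -/
theorem lymSum_eq {N n : ℕ} (F : Finset (Finset (Fin N))) (S T : Finset (Fin N))
    (hST : Disjoint S T) (hn : S.card = n + 1) :
    lymSum F S T = (if T ∈ F then 1 else 0) +
      (∑ k ∈ S, lymSum F (S.erase k) (insert k T)) / (n + 1) := by
  have h1 : ∑ k ∈ S, lymSum F (S.erase k) (insert k T) =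
      ∑ η ∈ F with T ⊆ η ∧ η \ T ⊆ S,
        ((η \ T).card : ℝ) * ((n.choose ((η \ T).card - 1) : ℝ))⁻¹ := by
    have h2 : ∀ k ∈ S, lymSum F (S.erase k) (insert k T) =
        ∑ η ∈ F with T ⊆ η ∧ η \ T ⊆ S,
          if k ∈ η \ T then ((n.choose ((η \ T).card - 1) : ℝ))⁻¹ else 0 := by
      intro k hk
      have hkT : k ∉ T := Finset.disjoint_left.mp hST hk
      rw [lymSum, ← Finset.sum_filter, Finset.filter_filter]
      have hfil : (F.filter fun η => insert k T ⊆ η ∧ η \ insert k T ⊆ S.erase k) =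
          F.filter fun η => (T ⊆ η ∧ η \ T ⊆ S) ∧ k ∈ η \ T := by
        apply Finset.filter_congr
        intro η _
        simp only [Finset.subset_iff, Finset.mem_insert, Finset.mem_sdiff, Finset.mem_erase]
        grind
      rw [hfil]
      apply Finset.sum_congr rfl
      intro η hη
      have hkη := (Finset.mem_filter.mp hη).2.2
      have : η \ insert k T = (η \ T).erase k := by
        ext x; simp only [Finset.mem_insert, Finset.mem_sdiff, Finset.mem_erase]; grind
      rw [this, Finset.card_erase_of_mem hkη, Finset.card_erase_of_mem hk, hn]
      simp
    rw [Finset.sum_congr rfl h2, Finset.sum_comm]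
    apply Finset.sum_congr rfl
    intro η hη
    have hsub := (Finset.mem_filter.mp hη).2.2
    rw [← Finset.sum_filter, Finset.sum_const, nsmul_eq_mul,
      Finset.filter_mem_eq_inter, Finset.inter_eq_right.mpr hsub]
  have h3 : (if T ∈ F then (1 : ℝ) else 0) =
      ∑ η ∈ F with T ⊆ η ∧ η \ T ⊆ S, if η = T then (1 : ℝ) else 0 := by
    rw [Finset.sum_ite_eq']
    simp
  rw [h1, h3, Finset.sum_div, ← Finset.sum_add_distrib, lymSum]
  apply Finset.sum_congr rfl
  intro η hη
  obtain ⟨-, hTη, hsub⟩ := Finset.mem_filter.mp hη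
  by_cases h : η = T
  · subst h; simp
  · have hpos : (η \ T).card ≠ 0 := by
      rw [Finset.card_ne_zero, Finset.sdiff_nonempty]
      exact fun h' => h (Finset.Subset.antisymm h' hTη)
    obtain ⟨j, hj⟩ := Nat.exists_eq_succ_of_ne_zero hpos
    have hle : j + 1 ≤ n + 1 := by
      rw [← hn, ← Nat.succ_eq_add_one, ← hj]; exact Finset.card_le_card hsub
    rw [if_neg h, hj, hn]
    have hc := Nat.add_one_mul_choose_eq n j
    have hc' : ((n : ℝ) + 1) * n.choose j = (n + 1).choose (j + 1) * ((j : ℝ) + 1) := by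
      exact_mod_cast hc
    have hp1 : (0 : ℝ) < n.choose j := by exact_mod_cast Nat.choose_pos (by omega)
    have hp2 : (0 : ℝ) < (n + 1).choose (j + 1) := by exact_mod_cast Nat.choose_pos hle
    simp only [Nat.succ_eq_add_one, Nat.add_sub_cancel, Nat.cast_add, Nat.cast_one, zero_add]
    field_simp
    linarith

/-- LYM inequality for Sperner-type families relative to the interval `[T, T ∪ S]`. -/
theorem lymSum_le {N : ℕ} (F : Finset (Finset (Fin N))) {κ : ℝ} (hκ : 0 < κ) (hκ1 : κ ≤ 1)
    (n : ℕ) : ∀ S T : Finset (Fin N), S.card = n → Disjoint S T →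
      (∀ η ∈ F, T ⊆ η → ∃ B ⊆ S, Disjoint B η ∧ κ * ((S \ η).card : ℝ) ≤ (B.card : ℝ) ∧
        ∀ η' ∈ F, η ⊆ η' → Disjoint η' B) →
      lymSum F S T ≤ 1 / κ := by
  induction n with
  | zero =>
    intro S T hS hST hF
    have hS' := Finset.card_eq_zero.mp hS
    subst hS'
    have hle : lymSum F ∅ T ≤ 1 := by
      have hfil : (F.filter fun η => T ⊆ η ∧ η \ T ⊆ ∅) ⊆ {T} := by
        intro η hη
        obtain ⟨-, h1, h2⟩ := Finset.mem_filter.mp hη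
        rw [Finset.mem_singleton]
        exact Finset.Subset.antisymm
          (Finset.sdiff_eq_empty_iff_subset.mp (Finset.subset_empty.mp h2)) h1
      rw [lymSum]
      refine (Finset.sum_le_sum_of_subset_of_nonneg hfil fun _ _ _ => by positivity).trans ?_
      simp
    exact hle.trans (by rw [le_div_iff₀ hκ]; linarith)
  | succ n ih =>
    intro S T hS hST hF
    have hstep : ∀ k ∈ S, lymSum F (S.erase k) (insert k T) ≤ 1 / κ := by
      intro k hk
      apply ih
      · rw [Finset.card_erase_of_mem hk, hS]; rfl
      · rw [Finset.disjoint_left] at hST ⊢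
        intro x hx
        simp only [Finset.mem_erase, Finset.mem_insert] at hx ⊢
        grind
      · intro η hη hTη
        obtain ⟨B, hBS, hBη, hBc, hB⟩ := hF η hη ((Finset.subset_insert _ _).trans hTη)
        have hkη : k ∈ η := hTη (Finset.mem_insert_self _ _)
        refine ⟨B, ?_, hBη, ?_, hB⟩
        · intro x hx
          refine Finset.mem_erase.mpr ⟨?_, hBS hx⟩
          rintro rfl
          exact Finset.disjoint_left.mp hBη hx hkη
        · have : S.erase k \ η = S \ η := by
            ext x; simp only [Finset.mem_sdiff, Finset.mem_erase]; grind
          rwa [this]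
    rw [lymSum_eq F S T hST hS]
    have hn : (0 : ℝ) < n + 1 := by positivity
    by_cases hT : T ∈ F
    · obtain ⟨B, hBS, hBT, hBc, hB⟩ := hF T hT (Finset.Subset.refl _)
      rw [Finset.sdiff_eq_self_of_disjoint hST, hS] at hBc
      have hz : ∀ k ∈ B, lymSum F (S.erase k) (insert k T) = 0 := by
        intro k hk
        rw [lymSum, Finset.filter_eq_empty_iff.mpr, Finset.sum_empty]
        rintro η hη ⟨h1, -⟩
        exact Finset.disjoint_left.mp (hB η hη ((Finset.subset_insert _ _).trans h1))
          (h1 (Finset.mem_insert_self _ _)) hk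
      have hsum : ∑ k ∈ S, lymSum F (S.erase k) (insert k T) ≤ (n + 1 - B.card) * (1 / κ) := by
        rw [← Finset.sum_sdiff hBS, Finset.sum_eq_zero hz, add_zero]
        refine (Finset.sum_le_card_nsmul _ _ (1 / κ)
          fun k hk => hstep k (Finset.mem_sdiff.mp hk).1).trans ?_
        rw [nsmul_eq_mul, Finset.card_sdiff_of_subset hBS,
          Nat.cast_sub (Finset.card_le_card hBS), hS]
        push_cast
        exact le_rfl
      rw [if_pos hT]
      push_cast at hBc
      have h2 : (∑ k ∈ S, lymSum F (S.erase k) (insert k T)) / (n + 1) ≤ (1 - κ) * (1 / κ) := by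
        rw [div_le_iff₀ hn]
        refine hsum.trans ?_
        have : (n + 1 - B.card : ℝ) ≤ (1 - κ) * (n + 1) := by linarith
        calc (n + 1 - B.card : ℝ) * (1 / κ) ≤ ((1 - κ) * (n + 1)) * (1 / κ) := by gcongr
          _ = _ := by ring
      have h3 : (1 - κ) * (1 / κ) = 1 / κ - 1 := by field_simp
      linarith
    · rw [if_neg hT, zero_add, div_le_iff₀ hn]
      refine (Finset.sum_le_card_nsmul _ _ (1 / κ) hstep).trans ?_
      rw [nsmul_eq_mul, hS]
      push_cast
      linarith

theorem centralBinom_sq_mul_le (m : ℕ) : m.centralBinom ^ 2 * (2 * m + 1) ≤ 16 ^ m := by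
  induction m with
  | zero => simp
  | succ m ih =>
    have h := Nat.succ_mul_centralBinom_succ m
    have h2 : (m + 1) ^ 2 * ((m + 1).centralBinom ^ 2 * (2 * (m + 1) + 1)) ≤
        (m + 1) ^ 2 * 16 ^ (m + 1) := by
      calc (m + 1) ^ 2 * ((m + 1).centralBinom ^ 2 * (2 * (m + 1) + 1))
          = ((m + 1) * (m + 1).centralBinom) ^ 2 * (2 * (m + 1) + 1) := by ring
        _ = (m.centralBinom ^ 2 * (2 * m + 1)) * (4 * (2 * m + 1) * (2 * m + 3)) := by
            rw [h]; ring
        _ ≤ 16 ^ m * (16 * (m + 1) ^ 2) := by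
            exact Nat.mul_le_mul ih (by nlinarith)
        _ = _ := by ring
    exact Nat.le_of_mul_le_mul_left h2 (by positivity)

theorem choose_half_sq_mul_le (n : ℕ) : (n.choose (n / 2)) ^ 2 * (n + 1) ≤ 4 ^ n := by
  obtain ⟨m, rfl | rfl⟩ := Nat.even_or_odd' n
  · have := centralBinom_sq_mul_le m
    rw [Nat.centralBinom_eq_two_mul_choose] at this
    rw [Nat.mul_div_cancel_left _ (by norm_num), pow_mul]
    exact this
  · have h := centralBinom_sq_mul_le (m + 1)
    have h2 : (m + 1).centralBinom = 2 * (2 * m + 1).choose m := by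
      rw [Nat.centralBinom_eq_two_mul_choose, show 2 * (m + 1) = 2 * m + 1 + 1 by ring,
        Nat.choose_succ_succ, Nat.choose_symm_half]
      ring
    have h3 : (2 * m + 1) / 2 = m := by omega
    rw [h3]
    rw [h2] at h
    have h4 : (16 : ℕ) ^ (m + 1) = 4 * 4 ^ (2 * m + 1) := by
      rw [show (16 : ℕ) = 4 ^ 2 by norm_num, ← pow_mul]; ring
    rw [h4] at h
    nlinarith [sq_nonneg ((2 * m + 1).choose m)]

theorem choose_le_two_pow_div_sqrt (n k : ℕ) :
    (n.choose k : ℝ) ≤ 2 ^ n / Real.sqrt (n + 1) := by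
  have h1 : (n.choose k : ℝ) ≤ n.choose (n / 2) := by exact_mod_cast Nat.choose_le_middle k n
  refine h1.trans ?_
  rw [le_div_iff₀ (by positivity)]
  refine (sq_le_sq₀ (by positivity) (by positivity)).mp ?_
  rw [mul_pow, Real.sq_sqrt (by positivity), ← pow_mul, mul_comm n 2, pow_mul]
  have := choose_half_sq_mul_le n
  norm_num
  exact_mod_cast this

/-- Bound on the number of members of a Sperner-type family which agree with `T` off `S`. -/
theorem card_fiber_le {N : ℕ} (F : Finset (Finset (Fin N))) {κ : ℝ} (hκ : 0 < κ) (hκ1 : κ ≤ 1)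
    (S T : Finset (Fin N)) (hST : Disjoint S T)
    (hF : ∀ η ∈ F, ∃ B ⊆ S, Disjoint B η ∧ κ * ((S \ η).card : ℝ) ≤ (B.card : ℝ) ∧
        ∀ η' ∈ F, η ⊆ η' → Disjoint η' B) :
    ((F.filter fun η => η \ S = T).card : ℝ) ≤
      2 ^ S.card / (κ * Real.sqrt (S.card + 1)) := by
  have h := lymSum_le F hκ hκ1 S.card S T rfl hST fun η hη _ => hF η hη
  have hc : (F.filter fun η => η \ S = T).card * (Real.sqrt (S.card + 1) / 2 ^ S.card) ≤
      lymSum F S T := by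
    rw [lymSum, ← nsmul_eq_mul]
    have hsub : (F.filter fun η => η \ S = T) ⊆ F.filter fun η => T ⊆ η ∧ η \ T ⊆ S := by
      intro η hη
      obtain ⟨h1, rfl⟩ := Finset.mem_filter.mp hη
      exact Finset.mem_filter.mpr ⟨h1, Finset.sdiff_subset, by simp⟩
    refine le_trans ?_ (Finset.sum_le_sum_of_subset_of_nonneg hsub fun _ _ _ => by positivity)
    apply Finset.card_nsmul_le_sum
    intro η hη
    obtain ⟨-, -, h2⟩ := Finset.mem_filter.mp (hsub hη)
    have hpos : (0 : ℝ) < S.card.choose (η \ T).card := by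
      exact_mod_cast Nat.choose_pos (Finset.card_le_card h2)
    have := choose_le_two_pow_div_sqrt S.card (η \ T).card
    rw [← inv_div]
    exact inv_anti₀ hpos this
  have h' := hc.trans h
  rw [le_div_iff₀ hκ] at h'
  rw [le_div_iff₀ (by positivity)]
  have h2 : (0 : ℝ) < 2 ^ S.card := by positivity
  have : (F.filter fun η => η \ S = T).card * (Real.sqrt (S.card + 1) / 2 ^ S.card) * κ =
    ((F.filter fun η => η \ S = T).card * (κ * Real.sqrt (S.card + 1))) / 2 ^ S.card := by ring
  rw [this, div_le_one h2] at h'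
  exact h'

/-- The weight `p k - β` or `1 - p k - β` left over after removing a fair coin of mass `2 * β`. -/
noncomputable def coinResidual {N : ℕ} (β : ℝ) (p : Fin N → ℝ) (η : Finset (Fin N)) (k : Fin N) : ℝ :=
  if k ∈ η then p k - β else 1 - p k - β

/-- Joint weight of the outcome `η` and of the set `S` of coordinates given by fair coins. -/
noncomputable def jointWeight {N : ℕ} (β : ℝ) (p : Fin N → ℝ) (S η : Finset (Fin N)) : ℝ :=
  β ^ S.card * ∏ k ∈ Sᶜ, coinResidual β p η k

theorem coinResidual_nonneg {N : ℕ} {β : ℝ} {p : Fin N → ℝ}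
    (hp : ∀ k, β ≤ min (p k) (1 - p k)) (η : Finset (Fin N)) (k : Fin N) :
    0 ≤ coinResidual β p η k := by
  have := le_min_iff.mp (hp k)
  unfold coinResidual
  split_ifs <;> linarith

theorem jointWeight_nonneg {N : ℕ} {β : ℝ} (hβ : 0 < β) {p : Fin N → ℝ}
    (hp : ∀ k, β ≤ min (p k) (1 - p k)) (S η : Finset (Fin N)) :
    0 ≤ jointWeight β p S η :=
  mul_nonneg (by positivity) (Finset.prod_nonneg fun k _ => coinResidual_nonneg hp η k)

theorem prodWeight_eq_prod {N : ℕ} (β : ℝ) (p : Fin N → ℝ) (η : Finset (Fin N)) :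
    prodWeight p η = ∏ k, (β + coinResidual β p η k) := by
  rw [prodWeight, ← Finset.prod_mul_prod_compl η]
  congr 1 <;> apply Finset.prod_congr rfl <;> intro k hk
  · simp [coinResidual, hk]
  · simp [coinResidual, Finset.mem_compl.mp hk]

theorem prod_add_eq_sum {N : ℕ} (β : ℝ) (f : Fin N → ℝ) :
    ∏ k, (β + f k) = ∑ S : Finset (Fin N), β ^ S.card * ∏ k ∈ Sᶜ, f k := by
  rw [Finset.prod_add, Finset.powerset_univ]
  simp [Finset.compl_eq_univ_sdiff]

theorem sum_jointWeight {N : ℕ} (β : ℝ) (p : Fin N → ℝ) (η : Finset (Fin N)) :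
    ∑ S, jointWeight β p S η = prodWeight p η := by
  rw [prodWeight_eq_prod β, prod_add_eq_sum]; rfl

theorem le_sum_jointWeight_mem {N : ℕ} {β : ℝ} (hβ : 0 < β) {p : Fin N → ℝ}
    (hp : ∀ k, β ≤ min (p k) (1 - p k)) (η : Finset (Fin N)) (b : Fin N) :
    β * prodWeight p η ≤ ∑ S with b ∈ S, jointWeight β p S η := by
  have h1 : ∑ S with b ∈ S, jointWeight β p S η =
      ∏ k, (β + if k = b then 0 else coinResidual β p η k) := by
    rw [prod_add_eq_sum, Finset.sum_filter]
    apply Finset.sum_congr rfl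
    intro S _
    split_ifs with hb
    · rw [jointWeight]
      congr 1
      apply Finset.prod_congr rfl
      intro k hk
      rw [if_neg]
      rintro rfl
      exact Finset.mem_compl.mp hk hb
    · rw [Finset.prod_eq_zero (Finset.mem_compl.mpr hb) (by simp), mul_zero]
  have h2 : β * prodWeight p η =
      ∏ k, ((if k = b then β else 1) * (β + coinResidual β p η k)) := by
    rw [Finset.prod_mul_distrib, ← prodWeight_eq_prod]
    simp
  rw [h1, h2]
  apply Finset.prod_le_prod
  · intro k _
    have := coinResidual_nonneg hp η k
    split_ifs <;> positivity
  · intro k _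
    have h3 := le_min_iff.mp (hp k)
    split_ifs with h
    · have : β + coinResidual β p η k ≤ 1 := by
        unfold coinResidual; split_ifs <;> linarith
      nlinarith
    · simp

/-- With conditional probability at least `β / 2`, the fair coins catch a fraction `β / 2`
of a given set `B`. -/
theorem le_sum_jointWeight_card {N : ℕ} {β : ℝ} (hβ : 0 < β) {p : Fin N → ℝ}
    (hp : ∀ k, β ≤ min (p k) (1 - p k)) (hβ2 : β ≤ 1 / 2) (η B : Finset (Fin N)) :
    β / 2 * prodWeight p η ≤
      ∑ S with β / 2 * (B.card : ℝ) ≤ ((B ∩ S).card : ℝ), jointWeight β p S η := by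
  have hw : 0 ≤ prodWeight p η := by
    rw [← sum_jointWeight β]
    exact Finset.sum_nonneg fun S _ => jointWeight_nonneg hβ hp S η
  rcases Nat.eq_zero_or_pos B.card with hB | hB
  · rw [Finset.filter_true_of_mem, sum_jointWeight]
    · nlinarith
    · intro S _; rw [hB]; simp
  have hB' : (0 : ℝ) < B.card := by exact_mod_cast hB
  have h1 : (B.card : ℝ) * (β * prodWeight p η) ≤
      ∑ S, jointWeight β p S η * ((B ∩ S).card : ℝ) := by
    calc (B.card : ℝ) * (β * prodWeight p η)
        ≤ ∑ b ∈ B, ∑ S with b ∈ S, jointWeight β p S η := by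
          rw [← nsmul_eq_mul]
          exact Finset.card_nsmul_le_sum _ _ _ fun b _ => le_sum_jointWeight_mem hβ hp η b
      _ = ∑ S, jointWeight β p S η * ((B ∩ S).card : ℝ) := by
          simp_rw [Finset.sum_filter]
          rw [Finset.sum_comm]
          apply Finset.sum_congr rfl
          intro S _
          rw [← Finset.sum_filter, Finset.filter_mem_eq_inter, Finset.sum_const, nsmul_eq_mul,
            mul_comm]
  have h2 : ∑ S, jointWeight β p S η * ((B ∩ S).card : ℝ) ≤
      (∑ S with β / 2 * (B.card : ℝ) ≤ ((B ∩ S).card : ℝ), jointWeight β p S η) * B.card +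
        prodWeight p η * (β / 2 * B.card) := by
    rw [← sum_jointWeight β, Finset.sum_filter, Finset.sum_mul, Finset.sum_mul,
      ← Finset.sum_add_distrib]
    apply Finset.sum_le_sum
    intro S _
    have hj := jointWeight_nonneg hβ hp S η
    split_ifs with h
    · have : ((B ∩ S).card : ℝ) ≤ B.card := by
        exact_mod_cast Finset.card_le_card Finset.inter_subset_left
      have h3 : 0 ≤ β / 2 * (B.card : ℝ) := by positivity
      nlinarith [mul_le_mul_of_nonneg_left this hj, mul_nonneg hj h3]
    · rw [zero_mul, zero_add]
      exact mul_le_mul_of_nonneg_left (not_le.mp h).le hj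
  have h3 := h1.trans h2
  refine le_of_mul_le_mul_right ?_ hB'
  linarith

theorem jointWeight_sdiff {N : ℕ} (β : ℝ) (p : Fin N → ℝ) (S η : Finset (Fin N)) :
    jointWeight β p S (η \ S) = jointWeight β p S η := by
  unfold jointWeight
  congr 1
  apply Finset.prod_congr rfl
  intro k hk
  simp [coinResidual, Finset.mem_compl.mp hk]

theorem sum_powerset_jointWeight {N : ℕ} (β : ℝ) (p : Fin N → ℝ) (S : Finset (Fin N)) :
    ∑ T ∈ Sᶜ.powerset, jointWeight β p S T = β ^ S.card * (1 - 2 * β) ^ (Sᶜ).card := by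
  unfold jointWeight
  rw [← Finset.mul_sum]
  congr 1
  have h : ∏ k ∈ Sᶜ, ((p k - β) + (1 - p k - β)) = (1 - 2 * β) ^ (Sᶜ).card := by
    rw [← Finset.prod_const]
    exact Finset.prod_congr rfl fun k _ => by ring
  rw [← h, Finset.prod_add]
  apply Finset.sum_congr rfl
  intro T hT
  rw [← Finset.prod_sdiff (Finset.mem_powerset.mp hT), mul_comm]
  congr 1 <;> apply Finset.prod_congr rfl <;> intro k hk
  · simp [coinResidual, hk]
  · simp [coinResidual, (Finset.mem_sdiff.mp hk).2]

theorem sum_jointWeight_le {N : ℕ} {β : ℝ} (hβ : 0 < β) {p : Fin N → ℝ}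
    (hp : ∀ k, β ≤ min (p k) (1 - p k)) (F : Finset (Finset (Fin N))) {κ : ℝ}
    (hκ : 0 < κ) (hκ1 : κ ≤ 1) (S : Finset (Fin N))
    (hF : ∀ η ∈ F, ∃ B ⊆ S, Disjoint B η ∧ κ * ((S \ η).card : ℝ) ≤ (B.card : ℝ) ∧
        ∀ η' ∈ F, η ⊆ η' → Disjoint η' B) :
    ∑ η ∈ F, jointWeight β p S η ≤
      (2 * β) ^ S.card * (1 - 2 * β) ^ (N - S.card) / (κ * Real.sqrt (S.card + 1)) := by
  have hmap : ∀ η ∈ F, η \ S ∈ Sᶜ.powerset := by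
    intro η _
    rw [Finset.mem_powerset]
    intro x hx
    exact Finset.mem_compl.mpr (Finset.mem_sdiff.mp hx).2
  rw [← Finset.sum_fiberwise_of_maps_to hmap]
  have h1 : ∀ T ∈ Sᶜ.powerset, ∑ η ∈ F with η \ S = T, jointWeight β p S η ≤
      2 ^ S.card / (κ * Real.sqrt (S.card + 1)) * jointWeight β p S T := by
    intro T hT
    have : ∀ η ∈ F.filter fun η => η \ S = T, jointWeight β p S η = jointWeight β p S T := by
      intro η hη
      rw [← (Finset.mem_filter.mp hη).2, jointWeight_sdiff]
    rw [Finset.sum_congr rfl this, Finset.sum_const, nsmul_eq_mul]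
    refine mul_le_mul_of_nonneg_right (card_fiber_le F hκ hκ1 S T ?_ hF)
      (jointWeight_nonneg hβ hp S T)
    rw [Finset.disjoint_left]
    exact fun x hx hxT => Finset.mem_compl.mp (Finset.mem_powerset.mp hT hxT) hx
  refine (Finset.sum_le_sum h1).trans (le_of_eq ?_)
  rw [← Finset.mul_sum, sum_powerset_jointWeight, Finset.card_compl, Fintype.card_fin]
  ring

theorem sum_binomial_eq_one (N : ℕ) (q : ℝ) :
    ∑ S : Finset (Fin N), q ^ S.card * (1 - q) ^ (N - S.card) = 1 := by
  have := prod_add_eq_sum (N := N) q fun _ => 1 - q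
  simp only [Finset.prod_const, Finset.card_compl, Fintype.card_fin] at this
  rw [← this]
  simp

theorem sum_binomial_div_le (N : ℕ) {q : ℝ} (hq : 0 < q) (hq1 : q ≤ 1) :
    ∑ S : Finset (Fin N), q ^ S.card * (1 - q) ^ (N - S.card) / (S.card + 1) ≤
      1 / (q * (N + 1)) := by
  have h0 := Finset.sum_powerset_apply_card
    (fun s => q ^ s * (1 - q) ^ (N - s) / ((s : ℝ) + 1)) (x := (Finset.univ : Finset (Fin N)))
  rw [Finset.powerset_univ, Finset.card_univ, Fintype.card_fin] at h0
  rw [h0, le_div_iff₀ (by positivity)]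
  have h1 := add_pow q (1 - q) (N + 1)
  rw [add_sub_cancel, one_pow, Finset.sum_range_succ'] at h1
  have h2 : (∑ m ∈ Finset.range (N + 1),
      N.choose m • (q ^ m * (1 - q) ^ (N - m) / ((m : ℝ) + 1))) * (q * (N + 1)) =
      ∑ m ∈ Finset.range (N + 1),
        q ^ (m + 1) * (1 - q) ^ (N + 1 - (m + 1)) * ((N + 1).choose (m + 1) : ℝ) := by
    rw [Finset.sum_mul]
    apply Finset.sum_congr rfl
    intro m _
    have hc : ((N : ℝ) + 1) * N.choose m = (N + 1).choose (m + 1) * ((m : ℝ) + 1) := by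
      exact_mod_cast Nat.add_one_mul_choose_eq N m
    have hm : (0 : ℝ) < m + 1 := by positivity
    rw [nsmul_eq_mul, Nat.add_sub_add_right, mul_div_assoc', div_mul_eq_mul_div,
      div_eq_iff hm.ne']
    linear_combination (q ^ (m + 1) * (1 - q) ^ (N - m)) * hc
  rw [h2]
  have h3 : 0 ≤ q ^ 0 * (1 - q) ^ (N + 1 - 0) * ((N + 1).choose 0 : ℝ) := by
    have : 0 ≤ 1 - q := by linarith
    positivity
  linarith

theorem sum_binomial_div_sqrt_le (N : ℕ) (hN : 1 ≤ N) {q : ℝ} (hq : 0 < q) (hq1 : q ≤ 1) :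
    ∑ S : Finset (Fin N), q ^ S.card * (1 - q) ^ (N - S.card) / Real.sqrt (S.card + 1) ≤
      1 / (Real.sqrt q * Real.sqrt N) := by
  have hN' : (0 : ℝ) < N := by exact_mod_cast hN
  have hq' : 0 ≤ 1 - q := by linarith
  set v : Finset (Fin N) → ℝ := fun S => q ^ S.card * (1 - q) ^ (N - S.card) with hv
  have hv0 : ∀ S, 0 ≤ v S := fun S => by positivity
  have hcs := Finset.sum_sq_le_sum_mul_sum_of_sq_le_mul Finset.univ
    (r := fun S => v S / Real.sqrt (S.card + 1)) (f := v)
    (g := fun S => v S / ((S.card : ℝ) + 1)) (fun S _ => hv0 S)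
    (fun S _ => div_nonneg (hv0 S) (by positivity)) (fun S _ => by
      rw [div_pow, Real.sq_sqrt (by positivity), sq, mul_div_assoc])
  rw [sum_binomial_eq_one, one_mul] at hcs
  have hr : 1 / (Real.sqrt q * Real.sqrt N) = Real.sqrt (1 / (q * N)) := by
    rw [← Real.sqrt_mul hq.le, Real.sqrt_div zero_le_one, Real.sqrt_one]
  rw [hr]
  apply Real.le_sqrt_of_sq_le
  refine hcs.trans ((sum_binomial_div_le N hq hq1).trans ?_)
  gcongr
  linarith

/-- For every `β ∈ (0,1/2]` there is `C_β > 0` such that for every `N ≥ 1`,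
every product distribution with parameters `p k ∈ [β, 1−β]`, every `κ ∈ (0,1]` and every
`κ`-Sperner family `A ⊆ 2^{Fin N}`, one has `P[ξ ∈ A] ≤ C_β/(κ·√N)`. -/
theorem stmt_7 (β : ℝ) (hβ0 : 0 < β) (hβ2 : β ≤ 1 / 2) :
    ∃ C : ℝ, 0 < C ∧
      ∀ (N : ℕ), 1 ≤ N → ∀ (p : Fin N → ℝ), (∀ k, β ≤ min (p k) (1 - p k)) →
        ∀ (κ : ℝ), 0 < κ → κ ≤ 1 →
          ∀ (A : Finset (Finset (Fin N))), IsSpernerFamily κ A →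
            ∑ η ∈ A, prodWeight p η ≤ C / (κ * Real.sqrt N) := by
  refine ⟨4 / (β ^ 2 * Real.sqrt (2 * β)), by positivity, ?_⟩
  intro N hN p hp κ hκ hκ1 A hA
  have hN' : (0 : ℝ) < N := by exact_mod_cast hN
  unfold IsSpernerFamily at hA
  choose! B hBsub hBcard hBdisj using hA
  set F : Finset (Fin N) → Finset (Finset (Fin N)) := fun S =>
    A.filter fun η => β / 2 * ((B η).card : ℝ) ≤ ((B η ∩ S).card : ℝ) with hF
  have hκ' : 0 < β * κ / 2 := by positivity
  have hκ1' : β * κ / 2 ≤ 1 := by nlinarith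
  have h1 : β / 2 * ∑ η ∈ A, prodWeight p η ≤ ∑ S, ∑ η ∈ F S, jointWeight β p S η := by
    calc β / 2 * ∑ η ∈ A, prodWeight p η
        ≤ ∑ η ∈ A, ∑ S with β / 2 * ((B η).card : ℝ) ≤ ((B η ∩ S).card : ℝ),
            jointWeight β p S η := by
          rw [Finset.mul_sum]
          exact Finset.sum_le_sum fun η _ => le_sum_jointWeight_card hβ0 hp hβ2 η (B η)
      _ = _ := by
          simp_rw [hF, Finset.sum_filter]
          rw [Finset.sum_comm]
  have h2 : ∀ S : Finset (Fin N), ∑ η ∈ F S, jointWeight β p S η ≤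
      (2 * β) ^ S.card * (1 - 2 * β) ^ (N - S.card) /
        (β * κ / 2 * Real.sqrt (S.card + 1)) := by
    intro S
    apply sum_jointWeight_le hβ0 hp (F S) hκ' hκ1'
    intro η hη
    obtain ⟨hηA, hgood⟩ := Finset.mem_filter.mp hη
    refine ⟨B η ∩ S, Finset.inter_subset_right, ?_, ?_, ?_⟩
    · rw [Finset.disjoint_left]
      intro x hx
      exact Finset.mem_compl.mp (hBsub η hηA (Finset.mem_inter.mp hx).1)
    · have hle : ((S \ η).card : ℝ) ≤ (ηᶜ).card := by
        have : S \ η ⊆ ηᶜ := fun x hx => Finset.mem_compl.mpr (Finset.mem_sdiff.mp hx).2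
        exact_mod_cast Finset.card_le_card this
      calc β * κ / 2 * ((S \ η).card : ℝ) ≤ β * κ / 2 * ((ηᶜ).card : ℝ) := by gcongr
        _ = β / 2 * (κ * ((ηᶜ).card : ℝ)) := by ring
        _ ≤ β / 2 * ((B η).card : ℝ) := by gcongr; exact hBcard η hηA
        _ ≤ _ := hgood
    · intro η' hη' hsub
      have := hBdisj η hηA η' (Finset.mem_filter.mp hη').1 hsub
      exact (Finset.disjoint_iff_inter_eq_empty.mpr this).mono_right Finset.inter_subset_left
  have h3 : ∑ S : Finset (Fin N), (2 * β) ^ S.card * (1 - 2 * β) ^ (N - S.card) /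
        (β * κ / 2 * Real.sqrt (S.card + 1)) ≤
      (β * κ / 2)⁻¹ * (1 / (Real.sqrt (2 * β) * Real.sqrt N)) := by
    refine le_trans (le_of_eq ?_) (mul_le_mul_of_nonneg_left
      (sum_binomial_div_sqrt_le N hN (q := 2 * β) (by positivity) (by linarith)) (by positivity))
    rw [Finset.mul_sum]
    apply Finset.sum_congr rfl
    intro S _
    rw [mul_comm (β * κ / 2), ← div_div, div_eq_mul_inv _ (β * κ / 2), mul_comm]
  have h4 := h1.trans ((Finset.sum_le_sum fun S _ => h2 S).trans h3)
  have hs : 0 < Real.sqrt (2 * β) := by positivity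
  have hs' : 0 < Real.sqrt N := by positivity
  calc ∑ η ∈ A, prodWeight p η = 2 / β * (β / 2 * ∑ η ∈ A, prodWeight p η) := by
        field_simp
    _ ≤ 2 / β * ((β * κ / 2)⁻¹ * (1 / (Real.sqrt (2 * β) * Real.sqrt N))) := by gcongr
    _ = _ := by field_simp; norm_num
end

section
/- Let N ≥ 1, let q₁,…,q_N be strictly positive real numbers, let ψ ⊆ {1,…,N}, let k ∈ {0,…,N−1}, and let j ≠ j' be elements of {1,…,N} with j ∉ ψ and j' ∉ ψ. Define h_j = Σ over subsets η ⊆ {1,…,N} with |η| = k and j ∉ η of (1/(|ψ\η| + 1))·Π_{ℓ∈η} q_ℓ, and define h_{j'} analogously with j' in place of j. Then h_j > 0, h_{j'} > 0, and min{1, q_j/q_{j'}} ≤ (q_j·h_j)/(q_{j'}·h_{j'}) ≤ max{1, q_j/q_{j'}}. -/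
open Finset

/-- The summand `(1 / (|ψ \ η| + 1)) * ∏ ℓ ∈ η, q ℓ` is multiplied by `q i` when an element
`i ∉ ψ` is inserted into `η`. -/
theorem weight_insert {ι : Type*} [DecidableEq ι] (q : ι → ℝ) {ψ η : Finset ι} {i : ι}
    (hψ : i ∉ ψ) (hη : i ∉ η) :
    (1 / (((ψ \ insert i η).card : ℝ) + 1)) * ∏ ℓ ∈ insert i η, q ℓ =
      q i * ((1 / (((ψ \ η).card : ℝ) + 1)) * ∏ ℓ ∈ η, q ℓ) := by
  rw [prod_insert hη, sdiff_insert_of_notMem hψ]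
  ring

/-- Splitting the sum over the `k`-subsets avoiding `a` according to membership of `b`. -/
theorem sum_weight_avoiding_eq {ι : Type*} [Fintype ι] [DecidableEq ι] (q : ι → ℝ)
    {ψ : Finset ι} (k : ℕ) {a b : ι} (hab : a ≠ b) (hb : b ∉ ψ) :
    (∑ η ∈ univ.filter (fun η : Finset ι => η.card = k ∧ a ∉ η),
        (1 / (((ψ \ η).card : ℝ) + 1)) * ∏ ℓ ∈ η, q ℓ) =
      (∑ η ∈ univ.filter (fun η : Finset ι => η.card = k ∧ a ∉ η ∧ b ∉ η),
        (1 / (((ψ \ η).card : ℝ) + 1)) * ∏ ℓ ∈ η, q ℓ) +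
      q b * ∑ η ∈ univ.filter (fun η : Finset ι => η.card + 1 = k ∧ a ∉ η ∧ b ∉ η),
        (1 / (((ψ \ η).card : ℝ) + 1)) * ∏ ℓ ∈ η, q ℓ := by
  rw [← sum_filter_not_add_sum_filter _ (fun η => b ∈ η), filter_filter, filter_filter]
  congr 1
  · simp only [and_assoc]
  · rw [mul_sum]
    symm
    refine sum_bij' (fun η _ => insert b η) (fun η _ => η.erase b) ?_ ?_ ?_ ?_ ?_
    · intro η h
      simp only [mem_filter, mem_univ, true_and] at h ⊢
      simp [card_insert_of_notMem h.2.2, h.1, h.2.1, hab]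
    · intro η h
      simp only [mem_filter, mem_univ, true_and] at h ⊢
      simp [card_erase_add_one h.2, h.1.1, h.1.2]
    · intro η h
      simp only [mem_filter, mem_univ, true_and] at h
      exact erase_insert h.2.2
    · intro η h
      simp only [mem_filter, mem_univ, true_and] at h
      exact insert_erase h.2
    · intro η h
      simp only [mem_filter, mem_univ, true_and] at h
      exact (weight_insert q hb h.2.2).symm

theorem weight_pos {ι : Type*} [DecidableEq ι] {q : ι → ℝ} (hq : ∀ ℓ, 0 < q ℓ)
    (ψ η : Finset ι) : 0 < (1 / (((ψ \ η).card : ℝ) + 1)) * ∏ ℓ ∈ η, q ℓ :=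
  mul_pos (by positivity) (prod_pos fun ℓ _ => hq ℓ)

theorem sum_weight_avoiding_pos {ι : Type*} [Fintype ι] [DecidableEq ι] {q : ι → ℝ}
    (hq : ∀ ℓ, 0 < q ℓ) (ψ : Finset ι) {k : ℕ} (hk : k ≤ Fintype.card ι - 1) (a : ι) :
    0 < ∑ η ∈ univ.filter (fun η : Finset ι => η.card = k ∧ a ∉ η),
        (1 / (((ψ \ η).card : ℝ) + 1)) * ∏ ℓ ∈ η, q ℓ := by
  refine sum_pos (fun η _ => weight_pos hq ψ η) ?_
  obtain ⟨η, hη, hcard⟩ := exists_subset_card_eq (s := univ.erase a) (n := k)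
    (by rwa [card_erase_of_mem (mem_univ a), card_univ])
  refine ⟨η, ?_⟩
  simp only [mem_filter, mem_univ, true_and]
  exact ⟨hcard, fun h => notMem_erase a univ (hη h)⟩

/-- Adding a common nonnegative amount `x * y * B` to `x * A` and `y * A` moves their ratio
towards `1`. -/
theorem min_le_ratio_and_ratio_le_max {x y A B : ℝ} (hx : 0 < x) (hy : 0 < y) (hA : 0 ≤ A)
    (hB : 0 ≤ B) (hpos : 0 < A + x * B) :
    min 1 (x / y) ≤ (x * (A + y * B)) / (y * (A + x * B)) ∧
      (x * (A + y * B)) / (y * (A + x * B)) ≤ max 1 (x / y) := by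
  have hden : 0 < y * (A + x * B) := mul_pos hy hpos
  rcases le_total x y with h | h
  · have hxy : x * B ≤ y * B := mul_le_mul_of_nonneg_right h hB
    refine ⟨min_le_of_right_le ?_, le_max_of_le_left ?_⟩
    · rw [mul_div_mul_comm]
      exact le_mul_of_one_le_right (by positivity) ((one_le_div hpos).2 (by linarith))
    · rw [div_le_one hden]
      linarith [mul_le_mul_of_nonneg_right h hA]
  · have hxy : y * B ≤ x * B := mul_le_mul_of_nonneg_right h hB
    refine ⟨min_le_of_left_le ?_, le_max_of_le_right ?_⟩
    · rw [one_le_div hden]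
      linarith [mul_le_mul_of_nonneg_right h hA]
    · rw [mul_div_mul_comm]
      exact mul_le_of_le_one_right (by positivity) ((div_le_one hpos).2 (by linarith))

/-- With `h_j` the sum over `η ⊆ {1,…,N}` with `|η| = k` and `j ∉ η` of
`(1/(|ψ\η|+1))·Π_{ℓ∈η} q_ℓ` (all `q_ℓ > 0`), one has `h_j, h_{j'} > 0` and
`min{1, q_j/q_{j'}} ≤ (q_j·h_j)/(q_{j'}·h_{j'}) ≤ max{1, q_j/q_{j'}}`. -/
theorem stmt_9 (N : ℕ) (hN : 1 ≤ N) (q : Fin N → ℝ) (hq : ∀ ℓ, 0 < q ℓ)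
    (ψ : Finset (Fin N)) (k : ℕ) (hk : k ≤ N - 1)
    (j j' : Fin N) (hjj' : j ≠ j') (hj : j ∉ ψ) (hj' : j' ∉ ψ) :
    0 < (∑ η ∈ Finset.univ.filter (fun η : Finset (Fin N) => η.card = k ∧ j ∉ η),
          (1 / (((ψ \ η).card : ℝ) + 1)) * ∏ ℓ ∈ η, q ℓ) ∧
    0 < (∑ η ∈ Finset.univ.filter (fun η : Finset (Fin N) => η.card = k ∧ j' ∉ η),
          (1 / (((ψ \ η).card : ℝ) + 1)) * ∏ ℓ ∈ η, q ℓ) ∧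
    min 1 (q j / q j') ≤
      (q j * ∑ η ∈ Finset.univ.filter (fun η : Finset (Fin N) => η.card = k ∧ j ∉ η),
          (1 / (((ψ \ η).card : ℝ) + 1)) * ∏ ℓ ∈ η, q ℓ) /
      (q j' * ∑ η ∈ Finset.univ.filter (fun η : Finset (Fin N) => η.card = k ∧ j' ∉ η),
          (1 / (((ψ \ η).card : ℝ) + 1)) * ∏ ℓ ∈ η, q ℓ) ∧
    (q j * ∑ η ∈ Finset.univ.filter (fun η : Finset (Fin N) => η.card = k ∧ j ∉ η),
          (1 / (((ψ \ η).card : ℝ) + 1)) * ∏ ℓ ∈ η, q ℓ) /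
      (q j' * ∑ η ∈ Finset.univ.filter (fun η : Finset (Fin N) => η.card = k ∧ j' ∉ η),
          (1 / (((ψ \ η).card : ℝ) + 1)) * ∏ ℓ ∈ η, q ℓ) ≤
      max 1 (q j / q j') := by
  have hk' : k ≤ Fintype.card (Fin N) - 1 := by rwa [Fintype.card_fin]
  have hpos := sum_weight_avoiding_pos hq ψ hk' j
  have hpos' := sum_weight_avoiding_pos hq ψ hk' j'
  refine ⟨hpos, hpos', ?_⟩
  have hswap := sum_weight_avoiding_eq q k hjj'.symm hj
  simp only [and_comm (a := j' ∉ _)] at hswap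
  rw [hswap] at hpos'
  rw [sum_weight_avoiding_eq q k hjj' hj', hswap]
  exact min_le_ratio_and_ratio_le_max (hq j) (hq j')
    (sum_nonneg fun η _ => (weight_pos hq ψ η).le)
    (sum_nonneg fun η _ => (weight_pos hq ψ η).le) hpos'
end
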